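/- Let $P(t,x) = \frac{1}{\sqrt{4\pi t}} e^{-x^2/(4t)} \mathbf{1}_{t>0}$ be the heat kernel on $\mathbb{R}$ and $P'$ its spatial derivative. Then for every $z = (t,x) \in \mathbb{R}^2$ with $z \ne 0$, one has the identity $2 \int_{\mathbb{R}^2} P'(z - \bar z) P'(-\bar z)\, d\bar z = P(z) + P(-z)$. -/

import Mathlib

open MeasureTheory

/-- The heat kernel on `ℝ`: `P(t,x) = (4πt)^{-1/2} e^{-x²/(4t)}` for `t > 0`, else `0`. -/
noncomputable def heatP (z : ℝ × ℝ) : ℝ :=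
  if 0 < z.1 then (Real.sqrt (4 * Real.pi * z.1))⁻¹ * Real.exp (-(z.2 ^ 2) / (4 * z.1))
  else 0

/-- The spatial derivative of the heat kernel. -/
noncomputable def heatP' (z : ℝ × ℝ) : ℝ := deriv (fun y => heatP (z.1, y)) z.2

open Filter Topology Set

lemma hp_eq (s y : ℝ) (hs : 0 < s) :
    heatP' (s, y) = -y / (2 * s) * ((Real.sqrt (4 * Real.pi * s))⁻¹ * Real.exp (-(y ^ 2) / (4 * s))) := by
  have h : HasDerivAt (fun y : ℝ => (Real.sqrt (4 * Real.pi * s))⁻¹ * Real.exp (-(y ^ 2) / (4 * s)))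
      ((Real.sqrt (4 * Real.pi * s))⁻¹ * (Real.exp (-(y ^ 2) / (4 * s)) * (-(2 * y) / (4 * s)))) y := by
    have h1 : HasDerivAt (fun y : ℝ => -(y ^ 2) / (4 * s)) (-(2 * y) / (4 * s)) y := by
      have := (((hasDerivAt_id y).pow 2).neg).div_const (4 * s)
      simpa using this
    exact (h1.exp).const_mul _
  have h2 : (fun y => heatP (s, y)) =
      fun y : ℝ => (Real.sqrt (4 * Real.pi * s))⁻¹ * Real.exp (-(y ^ 2) / (4 * s)) := by
    funext y; simp [heatP, hs]
  unfold heatP'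
  simp only [h2, h.deriv]
  field_simp
  ring

lemma hp_zero (s y : ℝ) (hs : s ≤ 0) : heatP' (s, y) = 0 := by
  have h2 : (fun y => heatP (s, y)) = fun y : ℝ => 0 := by
    funext y; simp [heatP, not_lt.mpr hs]
  unfold heatP'
  simp only [h2]
  simp

lemma hp_ite : heatP' = fun z : ℝ × ℝ => if 0 < z.1 then
    -z.2 / (2 * z.1) * ((Real.sqrt (4 * Real.pi * z.1))⁻¹ * Real.exp (-(z.2 ^ 2) / (4 * z.1))) else 0 := by
  funext ⟨s, y⟩
  by_cases h : 0 < s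
  · simp only [h, if_true]; exact hp_eq s y h
  · simp only [h, if_false]; exact hp_zero s y (not_lt.mp h)

lemma hp_meas : Measurable heatP' := by
  rw [hp_ite]
  refine Measurable.ite (measurableSet_lt measurable_const measurable_fst) ?_ measurable_const
  fun_prop

lemma gauss_quad (k β γ : ℝ) (hk : 0 < k) :
    ∫ u : ℝ, (u ^ 2 + β * u + γ) * Real.exp (-k * u ^ 2) = (γ + 1 / (2 * k)) * Real.sqrt (Real.pi / k) := by
  have i0 := integrable_exp_neg_mul_sq hk
  have i1 := integrable_mul_exp_neg_mul_sq hk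
  have i2 : Integrable (fun u : ℝ => u ^ 2 * Real.exp (-k * u ^ 2)) := by
    have := integrable_rpow_mul_exp_neg_mul_sq hk (s := 2) (by norm_num)
    simpa using this
  have d : ∀ u : ℝ, HasDerivAt (fun u : ℝ => -(1 / (2 * k)) * (u * Real.exp (-k * u ^ 2)) - β / (2 * k) * Real.exp (-k * u ^ 2))
      ((u ^ 2 * Real.exp (-k * u ^ 2) + β * (u * Real.exp (-k * u ^ 2))) - 1 / (2 * k) * Real.exp (-k * u ^ 2)) u := by
    intro u
    have h1 : HasDerivAt (fun u : ℝ => -k * u ^ 2) (-k * (2 * u)) u := by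
      simpa using ((hasDerivAt_id u).pow 2).const_mul (-k)
    have h2 := h1.exp
    have h3 := (((hasDerivAt_id u).mul h2).const_mul (-(1 / (2 * k)))).sub (h2.const_mul (β / (2 * k)))
    refine h3.congr_deriv ?_
    simp only [id]
    field_simp
    ring
  have z := integral_eq_zero_of_hasDerivAt_of_integrable d
    ((i2.add (i1.const_mul β)).sub (i0.const_mul _)) ((i1.const_mul _).sub (i0.const_mul _))
  have e : (fun u : ℝ => (u ^ 2 + β * u + γ) * Real.exp (-k * u ^ 2)) = fun u =>
     ((u ^ 2 * Real.exp (-k * u ^ 2) + β * (u * Real.exp (-k * u ^ 2))) - 1 / (2 * k) * Real.exp (-k * u ^ 2))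
      + (γ + 1 / (2 * k)) * Real.exp (-k * u ^ 2) := by
    funext u; ring
  have i3 : Integrable (fun u : ℝ => (u ^ 2 * Real.exp (-k * u ^ 2) + β * (u * Real.exp (-k * u ^ 2))) - 1 / (2 * k) * Real.exp (-k * u ^ 2)) :=
    (i2.add (i1.const_mul β)).sub (i0.const_mul _)
  rw [e, integral_add i3 (i0.const_mul _), z,
    integral_const_mul, integral_gaussian, zero_add]

/-- minus the second derivative of the kernel -/
noncomputable def negQ (c x : ℝ) : ℝ :=
  (Real.sqrt (4 * Real.pi * c))⁻¹ * ((2 * c - x ^ 2) / (4 * c ^ 2)) * Real.exp (-(x ^ 2) / (4 * c))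

lemma inner_eq (a b x : ℝ) (ha : 0 < a) (hb : 0 < b) :
    ∫ y : ℝ, heatP' (a, x + y) * heatP' (b, y) = negQ (a + b) x := by
  have hc : 0 < a + b := by positivity
  have hk : 0 < (a + b) / (4 * a * b) := by positivity
  have key : ∀ y : ℝ, heatP' (a, x + y) * heatP' (b, y) =
      (fun u : ℝ => ((1 / (4 * a * b)) * ((Real.sqrt (4 * Real.pi * a))⁻¹ * (Real.sqrt (4 * Real.pi * b))⁻¹)
        * Real.exp (-(x ^ 2) / (4 * (a + b)))) *
       ((u ^ 2 + ((a - b) * x / (a + b)) * u + (-(a * b * x ^ 2 / (a + b) ^ 2)))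
        * Real.exp (-((a + b) / (4 * a * b)) * u ^ 2))) (y + b * x / (a + b)) := by
    intro y
    rw [hp_eq _ _ ha, hp_eq _ _ hb]
    have e1 : Real.exp (-((x + y) ^ 2) / (4 * a)) * Real.exp (-(y ^ 2) / (4 * b)) =
      Real.exp (-(x ^ 2) / (4 * (a + b))) * Real.exp (-((a + b) / (4 * a * b)) * (y + b * x / (a + b)) ^ 2) := by
      rw [← Real.exp_add, ← Real.exp_add]
      congr 1
      field_simp
      ring
    have e2 : (y + b * x / (a + b)) ^ 2 + ((a - b) * x / (a + b)) * (y + b * x / (a + b)) + (-(a * b * x ^ 2 / (a + b) ^ 2))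
       = (x + y) * y := by
      field_simp
      ring
    simp only [e2]
    calc _ = (1 / (4 * a * b)) * ((Real.sqrt (4 * Real.pi * a))⁻¹ * (Real.sqrt (4 * Real.pi * b))⁻¹) * ((x + y) * y) *
          (Real.exp (-((x + y) ^ 2) / (4 * a)) * Real.exp (-(y ^ 2) / (4 * b))) := by
            field_simp
            ring
      _ = _ := by rw [e1]; ring
  rw [integral_congr_ae (Eventually.of_forall key)]
  refine (integral_add_right_eq_self (μ := (volume : Measure ℝ)) (fun u : ℝ => ((1 / (4 * a * b)) * ((Real.sqrt (4 * Real.pi * a))⁻¹ * (Real.sqrt (4 * Real.pi * b))⁻¹)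
        * Real.exp (-(x ^ 2) / (4 * (a + b)))) *
       ((u ^ 2 + ((a - b) * x / (a + b)) * u + (-(a * b * x ^ 2 / (a + b) ^ 2)))
        * Real.exp (-((a + b) / (4 * a * b)) * u ^ 2))) (b * x / (a + b))).trans ?_
  rw [integral_const_mul, gauss_quad _ _ _ hk]
  unfold negQ
  have s0 : Real.sqrt (Real.pi / ((a + b) / (4 * a * b))) =
      (Real.sqrt (4 * Real.pi * a)) * (Real.sqrt (4 * Real.pi * b)) / Real.sqrt (4 * Real.pi * (a + b)) := by
    rw [← Real.sqrt_mul (by positivity), ← Real.sqrt_div (by positivity)]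
    congr 1
    field_simp
  rw [s0]
  have p1 : 0 < Real.sqrt (4 * Real.pi * a) := by positivity
  have p2 : 0 < Real.sqrt (4 * Real.pi * b) := by positivity
  have p3 : 0 < Real.sqrt (4 * Real.pi * (a + b)) := by positivity
  field_simp
  ring

lemma heatP_bound (c x : ℝ) (hc : 0 < c) : heatP (c, x) ≤ (Real.sqrt (4 * Real.pi * c))⁻¹ := by
  simp only [heatP, hc, if_true]
  have : Real.exp (-(x ^ 2) / (4 * c)) ≤ 1 := by
    rw [Real.exp_le_one_iff]
    rw [neg_div]; have : 0 ≤ x ^ 2 / (4 * c) := by positivity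
    linarith
  exact mul_le_of_le_one_right (by positivity) this

lemma heatP_bound2 (c x : ℝ) (hc : 0 ≤ c) (hx : x ≠ 0) :
    heatP (c, x) ≤ Real.sqrt (4 * Real.pi * c) / (Real.pi * x ^ 2) := by
  rcases hc.eq_or_lt with rfl | hc
  · simp [heatP]
  simp only [heatP, hc, if_true]
  have hx2 : 0 < x ^ 2 := by positivity
  have h1 : Real.exp (-(x ^ 2) / (4 * c)) ≤ 4 * c / x ^ 2 := by
    rw [neg_div, Real.exp_neg]
    have := Real.add_one_le_exp (x ^ 2 / (4 * c))
    have h2 : x ^ 2 / (4 * c) ≤ Real.exp (x ^ 2 / (4 * c)) := by linarith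
    calc _ ≤ (x ^ 2 / (4 * c))⁻¹ := inv_anti₀ (by positivity) h2
      _ = _ := by rw [inv_div]
  have hS : Real.sqrt (4 * Real.pi * c) ^ 2 = 4 * Real.pi * c := Real.sq_sqrt (by positivity)
  have p : 0 < Real.sqrt (4 * Real.pi * c) := by positivity
  calc _ ≤ (Real.sqrt (4 * Real.pi * c))⁻¹ * (4 * c / x ^ 2) := by gcongr
    _ = _ := by
      have := Real.pi_pos
      field_simp
      rw [hS]

lemma heatP_nonneg (z : ℝ × ℝ) : 0 ≤ heatP z := by
  unfold heatP; split_ifs <;> positivity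

lemma heatP_time (c x : ℝ) (hc : 0 < c) : HasDerivAt (fun c => heatP (c, x)) (-negQ c x) c := by
  have e : (fun c => heatP (c, x)) =ᶠ[𝓝 c] fun c =>
      (Real.sqrt (4 * Real.pi * c))⁻¹ * Real.exp (-(x ^ 2) / (4 * c)) := by
    filter_upwards [lt_mem_nhds hc] with d hd
    simp [heatP, hd]
  refine HasDerivAt.congr_of_eventuallyEq ?_ e
  have hS : Real.sqrt (4 * Real.pi * c) ^ 2 = 4 * Real.pi * c := Real.sq_sqrt (by positivity)
  have p : 0 < Real.sqrt (4 * Real.pi * c) := by positivity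
  have hpi := Real.pi_pos
  have l : HasDerivAt (fun c : ℝ => 4 * Real.pi * c) (4 * Real.pi) c := by
    simpa using (hasDerivAt_id c).const_mul (4 * Real.pi)
  have h1 := (l.sqrt (by positivity)).inv p.ne'
  have l2 : HasDerivAt (fun c : ℝ => 4 * c) 4 c := by
    simpa using (hasDerivAt_id c).const_mul (4:ℝ)
  have h2 := ((hasDerivAt_const c (-(x^2))).div l2 (by positivity)).exp
  refine (h1.mul h2).congr_deriv ?_
  simp only [Pi.inv_apply, Pi.div_apply, hS]
  unfold negQ
  field_simp
  ring

lemma heat_lim_top (t x : ℝ) : Tendsto (fun s => heatP (t + 2 * s, x)) atTop (𝓝 0) := by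
  have ha : Tendsto (fun s : ℝ => t + 2 * s) atTop atTop :=
    tendsto_atTop_add_const_left _ _ (tendsto_id.const_mul_atTop (by norm_num))
  have hb : Tendsto (fun c : ℝ => (Real.sqrt (4 * Real.pi * c))⁻¹) atTop (𝓝 0) :=
    (Real.tendsto_sqrt_atTop.comp (tendsto_id.const_mul_atTop (by positivity))).inv_tendsto_atTop
  refine squeeze_zero' (Eventually.of_forall fun s => heatP_nonneg _) ?_ (hb.comp ha)
  filter_upwards [ha.eventually_gt_atTop 0] with s hs
  exact heatP_bound _ _ hs

lemma heat_cont (t x : ℝ) (ht : 0 ≤ t) (h : t ≠ 0 ∨ x ≠ 0) :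
    ContinuousWithinAt (fun s => heatP (t + 2 * s, x)) (Ici 0) 0 := by
  rcases ht.eq_or_lt with rfl | ht
  · have hx : x ≠ 0 := by simpa using h
    have hb : Tendsto (fun s : ℝ => Real.sqrt (4 * Real.pi * (0 + 2 * s)) / (Real.pi * x ^ 2)) (𝓝[Ici 0] 0) (𝓝 0) := by
      have : Continuous (fun s : ℝ => Real.sqrt (4 * Real.pi * (0 + 2 * s)) / (Real.pi * x ^ 2)) := by fun_prop
      have := (this.tendsto 0).mono_left (nhdsWithin_le_nhds (s := Ici 0))
      simpa using this
    have e : heatP (0 + 2 * 0, x) = 0 := by simp [heatP]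
    unfold ContinuousWithinAt
    show Tendsto _ _ (𝓝 (heatP (0 + 2 * 0, x)))
    rw [e]
    refine squeeze_zero' (Eventually.of_forall fun s => heatP_nonneg _) ?_ hb
    filter_upwards [self_mem_nhdsWithin] with s hs
    have hs : 0 ≤ s := hs
    exact heatP_bound2 _ _ (by linarith) hx
  · have h1 : ContinuousAt (fun c => heatP (c, x)) (t + 2 * 0) := by
      rw [mul_zero, add_zero]; exact (heatP_time t x ht).continuousAt
    exact (ContinuousAt.comp (f := fun s : ℝ => t + 2 * s) h1 (by fun_prop)).continuousWithinAt

lemma abs_gauss (s : ℝ) (hs : 0 < s) :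
    Integrable (fun y : ℝ => heatP' (s, y)) ∧ ∫ y, |heatP' (s, y)| = (Real.sqrt Real.pi)⁻¹ * s ^ (-(1/2) : ℝ) := by
  have hb : 0 < 1 / (4 * s) := by positivity
  have p : 0 < Real.sqrt (4 * Real.pi * s) := by positivity
  have e : (fun y : ℝ => heatP' (s, y)) = fun y =>
     (-(1 / (2 * s)) * (Real.sqrt (4 * Real.pi * s))⁻¹) * (y * Real.exp (-(1 / (4 * s)) * y ^ 2)) := by
    funext y; rw [hp_eq _ _ hs]
    have : -(y ^ 2) / (4 * s) = -(1 / (4 * s)) * y ^ 2 := by ring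
    rw [this]; ring
  refine ⟨by rw [e]; exact (integrable_mul_exp_neg_mul_sq hb).const_mul _, ?_⟩
  have e2 : (fun y : ℝ => |heatP' (s, y)|) = fun y => (fun r : ℝ =>
     ((1 / (2 * s)) * (Real.sqrt (4 * Real.pi * s))⁻¹) * (r * Real.exp (-(1 / (4 * s)) * r ^ 2))) |y| := by
    funext y
    have := congrFun e y
    rw [this]
    simp only [abs_mul, abs_neg, Real.abs_exp, sq_abs]
    rw [abs_of_pos (by positivity : 0 < 1 / (2 * s)), abs_of_pos (by positivity : 0 < (Real.sqrt (4 * Real.pi * s))⁻¹)]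
  rw [e2]
  refine (integral_comp_abs (f := fun r : ℝ =>
     ((1 / (2 * s)) * (Real.sqrt (4 * Real.pi * s))⁻¹) * (r * Real.exp (-(1 / (4 * s)) * r ^ 2)))).trans ?_
  rw [integral_const_mul]
  have : ∫ r in Ioi (0:ℝ), r * Real.exp (-(1 / (4 * s)) * r ^ 2) = 2 * s := by
    have h := integral_rpow_mul_exp_neg_mul_rpow (p := 2) (q := 1) (b := 1 / (4 * s)) (by norm_num) (by norm_num) hb
    have h2 : (-(1 + 1) / 2 : ℝ) = -1 := by norm_num
    have h3 : ((1 + 1) / 2 : ℝ) = 1 := by norm_num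
    simp only [Real.rpow_one, Real.rpow_two, h2, h3, Real.Gamma_one, Real.rpow_neg_one] at h
    rw [h]; field_simp; norm_num
  rw [this, Real.rpow_neg hs.le, ← Real.sqrt_eq_rpow]
  have : Real.sqrt (4 * Real.pi * s) = 2 * Real.sqrt Real.pi * Real.sqrt s := by
    rw [Real.sqrt_mul (by positivity), Real.sqrt_mul (by positivity)]
    rw [show (4:ℝ) = 2 ^ 2 by norm_num, Real.sqrt_sq (by norm_num)]
  rw [this]
  have : 0 < Real.sqrt s := by positivity
  field_simp

lemma hp_sup (c y : ℝ) (hc : 0 < c) : |heatP' (c, y)| ≤ c⁻¹ := by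
  rw [hp_eq _ _ hc]
  have hpi := Real.pi_gt_three
  have hS : Real.sqrt (4 * Real.pi * c) ^ 2 = 4 * Real.pi * c := Real.sq_sqrt (by positivity)
  have p : 0 < Real.sqrt (4 * Real.pi * c) := by positivity
  set S := Real.sqrt (4 * Real.pi * c)
  have hsc : |y| ≤ 2 * S * Real.exp (y ^ 2 / (4 * c)) := by
    have h1 := Real.add_one_le_exp (y ^ 2 / (4 * c))
    have h2 : |y| ≤ 2 * S * (y ^ 2 / (4 * c) + 1) := by
      have : 4 * c ≤ S ^ 2 := by rw [hS]; nlinarith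
      have h4 : |y| ^ 2 = y ^ 2 := sq_abs y
      have h5 : y ^ 2 / S ^ 2 ≤ y ^ 2 / (4 * c) := by gcongr
      have h6 : |y| ≤ 2 * S * (y ^ 2 / S ^ 2 + 1) := by
        rw [← h4]
        have : 2 * S * (|y| ^ 2 / S ^ 2 + 1) = (2 * |y| ^ 2 + 2 * S ^ 2) / S := by field_simp
        rw [this, le_div_iff₀ p]
        nlinarith [sq_nonneg (|y| - S), sq_nonneg (|y|), sq_nonneg S]
      refine h6.trans ?_
      gcongr
    refine h2.trans ?_
    gcongr
  rw [abs_mul, abs_div, abs_neg, abs_of_pos (by positivity : 0 < 2 * c),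
    abs_of_pos (by positivity : 0 < S⁻¹ * Real.exp (-(y ^ 2) / (4 * c))), neg_div, Real.exp_neg]
  have hE := Real.exp_pos (y ^ 2 / (4 * c))
  set E := Real.exp (y ^ 2 / (4 * c))
  have : |y| / (2 * c) * (S⁻¹ * E⁻¹) = |y| / (2 * S * E) * c⁻¹ := by field_simp
  rw [this]
  refine mul_le_of_le_one_left (by positivity) ?_
  rw [div_le_one (by positivity)]
  exact hsc

lemma time_int (t : ℝ) (ht : 0 < t) :
    IntegrableOn (fun s : ℝ => (t + s)⁻¹ * s ^ (-(1/2) : ℝ)) (Ioi 0) := by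
  rw [← Ioc_union_Ioi_eq_Ioi (zero_le_one (α := ℝ))]
  refine IntegrableOn.union ?_ ?_
  · have h : IntegrableOn (fun s : ℝ => t⁻¹ * s ^ (-(1/2) : ℝ)) (Ioc 0 1) := by
      have := (intervalIntegral.intervalIntegrable_rpow' (a := 0) (b := 1) (r := (-(1/2) : ℝ)) (by norm_num)).const_mul t⁻¹
      rwa [intervalIntegrable_iff_integrableOn_Ioc_of_le zero_le_one] at this
    refine Integrable.mono' h (by fun_prop) ?_
    refine (ae_restrict_iff' measurableSet_Ioc).2 (Eventually.of_forall fun s hs => ?_)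
    have := hs.1
    rw [Real.norm_of_nonneg (by positivity)]
    gcongr
    linarith
  · have h := integrableOn_Ioi_rpow_of_lt (a := (-(3/2) : ℝ)) (c := 1) (by norm_num) one_pos
    refine Integrable.mono' h (by fun_prop) ?_
    refine (ae_restrict_iff' measurableSet_Ioi).2 (Eventually.of_forall fun s hs => ?_)
    have hs : 1 < s := hs
    have hs0 : 0 < s := by linarith
    rw [Real.norm_of_nonneg (by positivity)]
    have : s ^ (-(3/2) : ℝ) = s⁻¹ * s ^ (-(1/2) : ℝ) := by
      rw [← Real.rpow_neg_one s, ← Real.rpow_add hs0]; norm_num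
    rw [this]
    gcongr
    linarith

lemma full_int (t x : ℝ) (ht : 0 < t) :
    Integrable (fun w : ℝ × ℝ => heatP' ((t, x) + w) * heatP' w) := by
  have hG : Integrable (fun w : ℝ × ℝ => (t + w.1)⁻¹ * heatP' w) := by
    have hm : AEStronglyMeasurable (fun w : ℝ × ℝ => (t + w.1)⁻¹ * heatP' w) (volume.prod volume) := by
      have := hp_meas
      exact Measurable.aestronglyMeasurable (by fun_prop)
    rw [Measure.volume_eq_prod, integrable_prod_iff hm]
    constructor
    · refine Eventually.of_forall fun s => ?_
      refine Integrable.const_mul (f := fun y : ℝ => heatP' (s, y)) ?_ ((t + s)⁻¹)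
      by_cases hs : 0 < s
      · exact (abs_gauss s hs).1
      · simp [hp_zero s _ (not_lt.mp hs)]
    · have : (fun s : ℝ => ∫ y : ℝ, ‖(t + s)⁻¹ * heatP' (s, y)‖) =
          (Ioi 0).indicator (fun s => (Real.sqrt Real.pi)⁻¹ * ((t + s)⁻¹ * s ^ (-(1/2) : ℝ))) := by
        funext s
        by_cases hs : 0 < s
        · rw [indicator_of_mem (show s ∈ Ioi 0 from hs)]
          simp only [norm_mul, Real.norm_eq_abs]
          rw [integral_const_mul, (abs_gauss s hs).2, abs_of_pos (by positivity)]
          ring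
        · rw [indicator_of_notMem (show s ∉ Ioi 0 from hs)]
          simp [hp_zero s _ (not_lt.mp hs)]
      simp only [this]
      rw [integrable_indicator_iff measurableSet_Ioi]
      exact (time_int t ht).const_mul _
  refine hG.mono ?_ (Eventually.of_forall fun w => ?_)
  · have := hp_meas
    exact Measurable.aestronglyMeasurable (by fun_prop)
  · obtain ⟨s, y⟩ := w
    by_cases hs : 0 < s
    · rw [norm_mul, norm_mul]
      refine mul_le_mul_of_nonneg_right ?_ (norm_nonneg _)
      rw [Real.norm_of_nonneg (by positivity : 0 ≤ (t + s)⁻¹)]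
      exact hp_sup _ _ (by positivity)
    · simp [hp_zero s _ (not_lt.mp hs)]

lemma core (t x : ℝ) (ht : 0 ≤ t) (h : t ≠ 0 ∨ x ≠ 0) :
    2 * ∫ w : ℝ × ℝ, heatP' ((t, x) + w) * heatP' w = heatP (t, x) := by
  by_cases hi : Integrable (fun w : ℝ × ℝ => heatP' ((t, x) + w) * heatP' w)
  swap
  · have h0 : t = 0 := by
      by_contra h0
      exact hi (full_int t x (lt_of_le_of_ne ht (Ne.symm h0)))
    rw [integral_undef hi]
    simp [heatP, h0]
  rw [Measure.volume_eq_prod] at hi ⊢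
  have e : (fun s : ℝ => ∫ y : ℝ, heatP' ((t, x) + (s, y)) * heatP' (s, y)) =
      (Ioi 0).indicator (fun s => negQ (t + 2 * s) x) := by
    funext s
    by_cases hs : 0 < s
    · rw [indicator_of_mem (show s ∈ Ioi 0 from hs)]
      have := inner_eq (t + s) s x (by linarith) hs
      rw [show t + 2 * s = t + s + s by ring, ← this]
      rfl
    · rw [indicator_of_notMem (show s ∉ Ioi 0 from hs)]
      simp [hp_zero s _ (not_lt.mp hs)]
  have hi2 := hi.integral_prod_left
  rw [integral_prod _ hi]
  simp only [e] at hi2 ⊢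
  rw [integrable_indicator_iff measurableSet_Ioi] at hi2
  rw [integral_indicator measurableSet_Ioi]
  have hd : ∀ s ∈ Ioi (0:ℝ), HasDerivAt (fun s => -(1/2) * heatP (t + 2 * s, x)) (negQ (t + 2 * s) x) s := by
    intro s hs
    have hs : 0 < s := hs
    have l : HasDerivAt (fun s : ℝ => t + 2 * s) 2 s := by
      simpa using ((hasDerivAt_id s).const_mul (2:ℝ)).const_add t
    have := ((heatP_time (t + 2 * s) x (by linarith)).comp s l).const_mul (-(1/2))
    refine this.congr_deriv ?_
    ring
  rw [integral_Ioi_of_hasDerivAt_of_tendsto ((heat_cont t x ht h).const_smul (-(1/2) : ℝ)) hd hi2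
    ((heat_lim_top t x).const_mul _)]
  simp

/-- The heat-kernel identity `2 ∫ P'(z - z̄) P'(-z̄) dz̄ = P(z) + P(-z)` for `z ≠ 0`. -/
theorem stmt5 (z : ℝ × ℝ) (hz : z ≠ 0) :
    2 * ∫ w : ℝ × ℝ, heatP' (z - w) * heatP' (-w) = heatP z + heatP (-z) := by
  have h1 : ∫ w : ℝ × ℝ, heatP' (z - w) * heatP' (-w) = ∫ w : ℝ × ℝ, heatP' (z + w) * heatP' w := by
    rw [← integral_neg_eq_self]
    simp
  rw [h1]
  obtain ⟨t, x⟩ := z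
  have hz' : t ≠ 0 ∨ x ≠ 0 := by
    by_contra hc
    push Not at hc
    exact hz (by rw [hc.1, hc.2]; rfl)
  rcases le_or_gt 0 t with ht | ht
  · rw [core t x ht hz']
    simp [heatP, not_lt.mpr ht]
  · have h2 : ∫ w : ℝ × ℝ, heatP' ((t, x) + w) * heatP' w =
        ∫ w : ℝ × ℝ, heatP' ((-t, -x) + w) * heatP' w := by
      rw [← integral_add_left_eq_self (fun w : ℝ × ℝ => heatP' ((-t, -x) + w) * heatP' w) (t, x)]
      congr 1
      funext w
      have : (-t, -x) + ((t, x) + w) = w := by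
        ext <;> simp
      rw [this, mul_comm]
    rw [h2, core (-t) (-x) (by linarith) (by simpa using hz')]
    simp [heatP, not_lt.mpr ht.le]
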